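/- Fix H > 0, 0 < B < 1, and a, b > 0 with a² ≤ b². Let x(s) = (1/H)·√(1 + B² + 2B·sin(Hs + 3π/2)), z(s) = ∫_{3π/(2H)}^{s + 3π/(2H)} (1 + B·sin(Ht))/√(1 + B² + 2B·sin(Ht)) dt, s₀ = (1/H)·arcsin(−B) + π/(2H), ρ(s) = x(s) − (x'(s)/z'(s))·z(s)·(b²/a²), and z₀ = (1 − B²)/(HB). If z(s₀) ≥ z₀, then ρ(s₀) ≤ 0, and there exists s̄ ∈ (0, s₀] with ρ(s̄) = 0 and ρ(−s̄) = 0; moreover a²x(s)² + b²z(s)² ≤ a²x(s̄)² + b²z(s̄)² for all s ∈ [−s̄, s̄]. -/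

import Mathlib

open Real

/-- Kenmotsu's profile function `x(s) = (1/H)√(1 + B² + 2B sin(Hs + 3π/2))`. -/
noncomputable def kenX (H B : ℝ) (s : ℝ) : ℝ :=
  (1 / H) * Real.sqrt (1 + B ^ 2 + 2 * B * Real.sin (H * s + 3 * Real.pi / 2))

/-- Kenmotsu's height function
`z(s) = ∫_{3π/(2H)}^{s + 3π/(2H)} (1 + B sin(Ht))/√(1 + B² + 2B sin(Ht)) dt`. -/
noncomputable def kenZ (H B : ℝ) (s : ℝ) : ℝ :=
  ∫ t in (3 * Real.pi / (2 * H))..(s + 3 * Real.pi / (2 * H)),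
    (1 + B * Real.sin (H * t)) / Real.sqrt (1 + B ^ 2 + 2 * B * Real.sin (H * t))

/-- The function `ρ` of the Kenmotsu unduloid. -/
noncomputable def kenRho (H B a b : ℝ) (s : ℝ) : ℝ :=
  kenX H B s - (deriv (kenX H B) s / deriv (kenZ H B) s) * kenZ H B s *
    (b ^ 2 / a ^ 2)

theorem sin_add_three_pi_div_two (y : ℝ) : sin (y + 3 * π / 2) = -cos y := by
  have h : y + 3 * π / 2 = (y + π) + π / 2 := by ring
  rw [h, sin_add_pi_div_two, cos_add_pi]

theorem kenX_eq (H B s : ℝ) :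
    kenX H B s = 1 / H * √(1 + B ^ 2 - 2 * B * cos (H * s)) := by
  rw [kenX, sin_add_three_pi_div_two]
  congr 2
  ring

theorem kenX_neg (H B s : ℝ) : kenX H B (-s) = kenX H B s := by
  simp [kenX_eq]

theorem radicand_pos {B : ℝ} (hB0 : 0 < B) (hB1 : B < 1) (y : ℝ) :
    0 < 1 + B ^ 2 - 2 * B * cos y := by
  nlinarith [cos_le_one y]

theorem one_sub_mul_cos_pos {B : ℝ} (hB0 : 0 < B) (hB1 : B < 1) (y : ℝ) :
    0 < 1 - B * cos y := by
  nlinarith [cos_le_one y]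

theorem kenX_pos {H B : ℝ} (hH : 0 < H) (hB0 : 0 < B) (hB1 : B < 1) (s : ℝ) :
    0 < kenX H B s := by
  have := radicand_pos hB0 hB1 (H * s)
  rw [kenX_eq]
  positivity

theorem kenX_le_kenX {H B s t : ℝ} (hH : 0 < H) (hB0 : 0 < B) (hs : 0 ≤ s) (hst : s ≤ t)
    (ht : H * t ≤ π) : kenX H B s ≤ kenX H B t := by
  have hcos : cos (H * t) ≤ cos (H * s) :=
    cos_le_cos_of_nonneg_of_le_pi (by positivity) ht (by gcongr)
  rw [kenX_eq, kenX_eq]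
  gcongr

theorem hasDerivAt_kenX {H B : ℝ} (hH : 0 < H) (hB0 : 0 < B) (hB1 : B < 1) (s : ℝ) :
    HasDerivAt (kenX H B) (B * sin (H * s) / √(1 + B ^ 2 - 2 * B * cos (H * s))) s := by
  have hw := radicand_pos hB0 hB1 (H * s)
  have hcos : HasDerivAt (fun s => cos (H * s)) (-sin (H * s) * H) s := by
    simpa using ((hasDerivAt_id s).const_mul H).cos
  have h := (((hcos.const_mul (2 * B)).const_sub (1 + B ^ 2)).sqrt hw.ne').const_mul (1 / H)
  rw [funext (kenX_eq H B)]
  refine h.congr_deriv ?_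
  have := (sqrt_pos.2 hw).ne'
  field_simp

theorem kenZ_eq {H : ℝ} (hH : 0 < H) (B s : ℝ) :
    kenZ H B s =
      ∫ t in (0 : ℝ)..s, (1 - B * cos (H * t)) / √(1 + B ^ 2 - 2 * B * cos (H * t)) := by
  have h := intervalIntegral.integral_comp_add_right (a := 0) (b := s)
    (fun t => (1 + B * sin (H * t)) / √(1 + B ^ 2 + 2 * B * sin (H * t))) (3 * π / (2 * H))
  rw [zero_add] at h
  rw [kenZ, ← h]
  congr 1
  ext t
  have ht : H * (t + 3 * π / (2 * H)) = H * t + 3 * π / 2 := by field_simp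
  simp only [ht, sin_add_three_pi_div_two, mul_neg, ← sub_eq_add_neg]

theorem continuous_kenZ_integrand {B : ℝ} (H : ℝ) (hB0 : 0 < B) (hB1 : B < 1) :
    Continuous fun t => (1 - B * cos (H * t)) / √(1 + B ^ 2 - 2 * B * cos (H * t)) :=
  Continuous.div (by fun_prop) (by fun_prop) fun t =>
    (sqrt_pos.2 (radicand_pos hB0 hB1 (H * t))).ne'

theorem hasDerivAt_kenZ {H B : ℝ} (hH : 0 < H) (hB0 : 0 < B) (hB1 : B < 1) (s : ℝ) :
    HasDerivAt (kenZ H B)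
      ((1 - B * cos (H * s)) / √(1 + B ^ 2 - 2 * B * cos (H * s))) s := by
  rw [funext (kenZ_eq hH B)]
  exact (continuous_kenZ_integrand H hB0 hB1).integral_hasStrictDerivAt 0 s |>.hasDerivAt

theorem kenZ_zero {H : ℝ} (hH : 0 < H) (B : ℝ) : kenZ H B 0 = 0 := by
  simp [kenZ_eq hH]

theorem kenZ_neg {H : ℝ} (hH : 0 < H) (B s : ℝ) : kenZ H B (-s) = -kenZ H B s := by
  have h := intervalIntegral.integral_comp_neg (a := 0) (b := s)
    (fun t => (1 - B * cos (H * t)) / √(1 + B ^ 2 - 2 * B * cos (H * t)))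
  simp only [mul_neg, cos_neg, neg_zero] at h
  rw [kenZ_eq hH, kenZ_eq hH, h, intervalIntegral.integral_symm]

theorem kenZ_monotone {H B : ℝ} (hH : 0 < H) (hB0 : 0 < B) (hB1 : B < 1) :
    Monotone (kenZ H B) :=
  monotone_of_hasDerivAt_nonneg (hasDerivAt_kenZ hH hB0 hB1) fun s =>
    div_nonneg (one_sub_mul_cos_pos hB0 hB1 (H * s)).le (sqrt_nonneg _)

theorem kenRho_eq {H B : ℝ} (hH : 0 < H) (hB0 : 0 < B) (hB1 : B < 1) (a b s : ℝ) :
    kenRho H B a b s =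
      kenX H B s - B * sin (H * s) / (1 - B * cos (H * s)) * kenZ H B s * (b ^ 2 / a ^ 2) := by
  have hw := (sqrt_pos.2 (radicand_pos hB0 hB1 (H * s))).ne'
  rw [kenRho, (hasDerivAt_kenX hH hB0 hB1 s).deriv, (hasDerivAt_kenZ hH hB0 hB1 s).deriv,
    div_div_div_cancel_right₀ hw]

theorem kenRho_neg {H B : ℝ} (hH : 0 < H) (hB0 : 0 < B) (hB1 : B < 1) (a b s : ℝ) :
    kenRho H B a b (-s) = kenRho H B a b s := by
  rw [kenRho_eq hH hB0 hB1, kenRho_eq hH hB0 hB1, kenX_neg, kenZ_neg hH, mul_neg H s, sin_neg,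
    cos_neg]
  ring

theorem continuous_kenRho {H B : ℝ} (hH : 0 < H) (hB0 : 0 < B) (hB1 : B < 1) (a b : ℝ) :
    Continuous (kenRho H B a b) := by
  have hX : Continuous (kenX H B) :=
    continuous_iff_continuousAt.2 fun s => (hasDerivAt_kenX hH hB0 hB1 s).continuousAt
  have hZ : Continuous (kenZ H B) :=
    continuous_iff_continuousAt.2 fun s => (hasDerivAt_kenZ hH hB0 hB1 s).continuousAt
  have hq : Continuous fun s => B * sin (H * s) / (1 - B * cos (H * s)) :=
    Continuous.div (by fun_prop) (by fun_prop) fun s => (one_sub_mul_cos_pos hB0 hB1 (H * s)).ne'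
  rw [funext (kenRho_eq hH hB0 hB1 a b)]
  exact hX.sub ((hq.mul hZ).mul continuous_const)

theorem kenRho_zero_pos {H B : ℝ} (hH : 0 < H) (hB0 : 0 < B) (hB1 : B < 1) (a b : ℝ) :
    0 < kenRho H B a b 0 := by
  simpa [kenRho_eq hH hB0 hB1, kenZ_zero hH] using kenX_pos hH hB0 hB1 0

/-- Where the profile is steepest, i.e. `H s = arccos B`, the height bound
`(1 - B²) / (H B) ≤ z(s)` forces `ρ(s) ≤ 0`. -/
theorem kenRho_nonpos {H B a b s : ℝ} (hH : 0 < H) (hB0 : 0 < B) (hB1 : B < 1) (ha : 0 < a)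
    (hab : a ^ 2 ≤ b ^ 2) (hs : H * s = arccos B) (hz : (1 - B ^ 2) / (H * B) ≤ kenZ H B s) :
    kenRho H B a b s ≤ 0 := by
  have hB2 : 0 < 1 - B ^ 2 := by nlinarith
  have hr : 1 ≤ b ^ 2 / a ^ 2 := (one_le_div (by positivity)).2 hab
  have hz0 : 0 ≤ kenZ H B s := le_trans (by positivity) hz
  have hcoef : 0 ≤ B * √(1 - B ^ 2) / (1 - B * B) :=
    div_nonneg (by positivity) (by nlinarith)
  rw [kenRho_eq hH hB0 hB1, kenX_eq, hs, sin_arccos, cos_arccos (by linarith) hB1.le,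
    show 1 + B ^ 2 - 2 * B * B = 1 - B ^ 2 by ring, sub_nonpos]
  calc 1 / H * √(1 - B ^ 2)
      = B * √(1 - B ^ 2) / (1 - B * B) * ((1 - B ^ 2) / (H * B)) := by
        rw [← sq]
        field_simp
    _ ≤ B * √(1 - B ^ 2) / (1 - B * B) * kenZ H B s := by gcongr
    _ ≤ B * √(1 - B ^ 2) / (1 - B * B) * kenZ H B s * (b ^ 2 / a ^ 2) :=
        le_mul_of_one_le_right (mul_nonneg hcoef hz0) hr

/-- On a symmetric interval within half a period, the ellipsoidal norm of the profile curve is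
largest at the endpoints. -/
theorem ellipsoid_norm_le {H B s t : ℝ} (hH : 0 < H) (hB0 : 0 < B) (hB1 : B < 1) (a b : ℝ)
    (ht : H * t ≤ π) (hs : s ∈ Set.Icc (-t) t) :
    a ^ 2 * kenX H B s ^ 2 + b ^ 2 * kenZ H B s ^ 2 ≤
      a ^ 2 * kenX H B t ^ 2 + b ^ 2 * kenZ H B t ^ 2 := by
  wlog h0 : 0 ≤ s generalizing s
  · have h := this (s := -s) ⟨neg_le_neg hs.2, neg_le.1 hs.1⟩ (by linarith)
    rwa [kenX_neg, kenZ_neg hH, neg_sq] at h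
  have hx := kenX_le_kenX hH hB0 h0 hs.2 ht
  have hx0 := (kenX_pos hH hB0 hB1 s).le
  have hz := kenZ_monotone hH hB0 hB1 hs.2
  have hz0 : 0 ≤ kenZ H B s := kenZ_zero hH B ▸ kenZ_monotone hH hB0 hB1 h0
  gcongr

/-- For the unduloid (`0 < B < 1`) with `a² ≤ b²`: if `z(s₀) ≥ z₀ = (1-B²)/(HB)`,
then `ρ(s₀) ≤ 0`, there is `s̄ ∈ (0, s₀]` with `ρ(s̄) = ρ(-s̄) = 0`, and
`a²x(s)² + b²z(s)² ≤ a²x(s̄)² + b²z(s̄)²` for all `s ∈ [-s̄, s̄]`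
(free boundary in the rotational ellipsoid). -/
theorem unduloid_free_boundary_exists (H B a b : ℝ) (hH : 0 < H) (hB0 : 0 < B)
    (hB1 : B < 1) (ha : 0 < a) (hb : 0 < b) (hab : a ^ 2 ≤ b ^ 2)
    (hz : kenZ H B ((1 / H) * Real.arcsin (-B) + Real.pi / (2 * H)) ≥
      (1 - B ^ 2) / (H * B)) :
    kenRho H B a b ((1 / H) * Real.arcsin (-B) + Real.pi / (2 * H)) ≤ 0 ∧
    ∃ sb ∈ Set.Ioc 0 ((1 / H) * Real.arcsin (-B) + Real.pi / (2 * H)),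
      kenRho H B a b sb = 0 ∧ kenRho H B a b (-sb) = 0 ∧
      ∀ s ∈ Set.Icc (-sb) sb,
        a ^ 2 * (kenX H B s) ^ 2 + b ^ 2 * (kenZ H B s) ^ 2 ≤
          a ^ 2 * (kenX H B sb) ^ 2 + b ^ 2 * (kenZ H B sb) ^ 2 := by
  have hs : H * ((1 / H) * arcsin (-B) + π / (2 * H)) = arccos B := by
    rw [arccos, arcsin_neg]
    field_simp
    ring
  set s₀ := (1 / H) * arcsin (-B) + π / (2 * H)
  have hs0 : 0 < s₀ := pos_of_mul_pos_right (hs ▸ arccos_pos.2 hB1) hH.le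
  have hρ := kenRho_nonpos hH hB0 hB1 ha hab hs hz
  refine ⟨hρ, ?_⟩
  obtain ⟨t, ht, htρ⟩ := intermediate_value_Icc' hs0.le
    (continuous_kenRho hH hB0 hB1 a b).continuousOn ⟨hρ, (kenRho_zero_pos hH hB0 hB1 a b).le⟩
  have ht0 : t ≠ 0 := by
    rintro rfl
    exact (kenRho_zero_pos hH hB0 hB1 a b).ne' htρ
  have htπ : H * t ≤ π := by
    calc H * t ≤ H * s₀ := by gcongr; exact ht.2
      _ ≤ π := hs ▸ arccos_le_pi B
  exact ⟨t, ⟨lt_of_le_of_ne ht.1 ht0.symm, ht.2⟩, htρ, by rw [kenRho_neg hH hB0 hB1, htρ],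
    fun s hst => ellipsoid_norm_le hH hB0 hB1 a b htπ hst⟩
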